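/- Bracketing a maximum-height position: let H₀, …, H_ℓ be a valid stack sequence for adaptation functions f₀, …, f_{ℓ−1} with |H₀| = |H_ℓ| = 1, and let j be a position with |H_j| = M. Then for every v with 1 ≤ v < M there exist positions i ≤ j ≤ k such that |H_i| = |H_k| = v, |H_p| > v for all p with i < p < k, the function f_i is an encapsulation, the function f_{k−1} is a decapsulation, and moreover H_i = H_k. -/

import Mathlib

/-- An adaptation function over a protocol set `A`: a conversion `(a→b)`,
an encapsulation `(a→ab)`, or a decapsulation `(a→ab)‾`. -/
inductive AdaptFun (A : Type) where
  | conv : A → A → AdaptFun A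
  | encap : A → A → AdaptFun A
  | decap : A → A → AdaptFun A
deriving DecidableEq

/-- The partial action of an adaptation function on a protocol stack
(a list whose head is the top of the stack). -/
def AdaptFun.apply {A : Type} [DecidableEq A] : AdaptFun A → List A → Option (List A)
  | .conv a b, x :: T => if x = a then some (b :: T) else none
  | .encap a b, x :: T => if x = a then some (b :: a :: T) else none
  | .decap a b, y :: x :: T => if y = b ∧ x = a then some (a :: T) else none
  | _, _ => none

/-- `H₀, …, H_ℓ` is a valid stack sequence for `f₀, …, f_{ℓ-1}`: for every `i < ℓ`,
the action of `f i` on `H i` is defined and equals `H (i+1)`. -/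
def ValidSeq {A : Type} [DecidableEq A] (f : ℕ → AdaptFun A) (H : ℕ → List A) (ℓ : ℕ) : Prop :=
  ∀ i < ℓ, (f i).apply (H i) = some (H (i + 1))

/-- Every defined step is a conversion of the top, a push, or a pop. -/
theorem AdaptFun.apply_eq_some_cases {A : Type} [DecidableEq A] {g : AdaptFun A}
    {S S' : List A} (h : g.apply S = some S') :
    (∃ x y T, S = x :: T ∧ S' = y :: T) ∨
    ((∃ a b, g = .encap a b) ∧ ∃ b, S' = b :: S) ∨
    ((∃ a b, g = .decap a b) ∧ ∃ b, S = b :: S') := by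
  rcases g with ⟨a, b⟩ | ⟨a, b⟩ | ⟨a, b⟩ <;> rcases S with _ | ⟨x, _ | ⟨y, T⟩⟩ <;>
    simp [AdaptFun.apply] at h ⊢ <;> grind

/-- A step from a stack strictly higher than `W` keeps `W` at the bottom. -/
theorem AdaptFun.isSuffix_of_apply {A : Type} [DecidableEq A] {g : AdaptFun A}
    {S S' W : List A} (h : g.apply S = some S') (hW : W <:+ S) (hlen : W.length < S.length) :
    W <:+ S' := by
  rcases AdaptFun.apply_eq_some_cases h with ⟨x, y, T, rfl, rfl⟩ | ⟨-, b, rfl⟩ | ⟨-, b, rfl⟩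
  · rcases List.suffix_cons_iff.1 hW with rfl | hT
    · exact absurd hlen (by simp)
    · exact hT.trans (List.suffix_cons _ _)
  · exact hW.trans (List.suffix_cons _ _)
  · rcases List.suffix_cons_iff.1 hW with rfl | hT
    · exact absurd hlen (lt_irrefl _)
    · exact hT

/-- A step that climbs from height at most `v` to height above `v` is an encapsulation. -/
theorem AdaptFun.encap_of_apply_of_length {A : Type} [DecidableEq A] {g : AdaptFun A}
    {S S' : List A} {v : ℕ} (h : g.apply S = some S') (hS : S.length ≤ v)
    (hS' : v < S'.length) :
    S.length = v ∧ (∃ a b, g = .encap a b) ∧ S <:+ S' := by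
  rcases AdaptFun.apply_eq_some_cases h with ⟨x, y, T, rfl, rfl⟩ | ⟨hg, b, rfl⟩ | ⟨-, b, rfl⟩ <;>
    simp only [List.length_cons] at hS hS'
  · omega
  · exact ⟨by omega, hg, List.suffix_cons _ _⟩
  · omega

/-- A step that drops from height above `v` to height at most `v` is a decapsulation. -/
theorem AdaptFun.decap_of_apply_of_length {A : Type} [DecidableEq A] {g : AdaptFun A}
    {S S' : List A} {v : ℕ} (h : g.apply S = some S') (hS : v < S.length)
    (hS' : S'.length ≤ v) :
    S'.length = v ∧ ∃ a b, g = .decap a b := by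
  rcases AdaptFun.apply_eq_some_cases h with ⟨x, y, T, rfl, rfl⟩ | ⟨-, b, rfl⟩ | ⟨hg, b, rfl⟩ <;>
    simp only [List.length_cons] at hS hS'
  · omega
  · omega
  · exact ⟨by omega, hg⟩

/-- A valid stack sequence that stays strictly higher than `W` keeps `W` at the bottom. -/
theorem ValidSeq.isSuffix {A : Type} [DecidableEq A] {f : ℕ → AdaptFun A} {H : ℕ → List A}
    {ℓ m n : ℕ} (hv : ValidSeq f H ℓ) {W : List A} (hW : W <:+ H m) (hmn : m ≤ n) (hn : n ≤ ℓ)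
    (hlen : ∀ p, m ≤ p → p < n → W.length < (H p).length) : W <:+ H n := by
  induction n, hmn using Nat.le_induction with
  | base => exact hW
  | succ n hmn ih =>
    exact AdaptFun.isSuffix_of_apply (hv n (by omega))
      (ih (by omega) fun p hp hpn => hlen p hp (by omega)) (hlen n hmn (by omega))

/-- Bracketing a maximum-height position: if `|H 0| = |H ℓ| = 1` and `|H j| = M`, then for
every `1 ≤ v < M` there are positions `i ≤ j ≤ k` with `|H i| = |H k| = v`, all strictly
intermediate heights `> v`, `f i` an encapsulation, `f (k-1)` a decapsulation, and `H i = H k`. -/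
theorem validSeq_bracketing {A : Type} [DecidableEq A]
    (f : ℕ → AdaptFun A) (H : ℕ → List A) (ℓ : ℕ) (hv : ValidSeq f H ℓ)
    (h0 : (H 0).length = 1) (hl : (H ℓ).length = 1)
    (j M : ℕ) (hj : j ≤ ℓ) (hM : (H j).length = M)
    (v : ℕ) (hv1 : 1 ≤ v) (hvM : v < M) :
    ∃ i k, i ≤ j ∧ j ≤ k ∧ k ≤ ℓ ∧
      (H i).length = v ∧ (H k).length = v ∧
      (∀ p, i < p → p < k → v < (H p).length) ∧
      (∃ a b, f i = AdaptFun.encap a b) ∧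
      (∃ a b, f (k - 1) = AdaptFun.decap a b) ∧
      H i = H k := by
  have hex : ∃ k, j ≤ k ∧ (H k).length ≤ v := ⟨ℓ, hj, by omega⟩
  obtain ⟨i, hij, hi, himax⟩ : ∃ i, i ≤ j ∧ (H i).length ≤ v ∧
      ∀ p, i < p → p ≤ j → v < (H p).length :=
    ⟨Nat.findGreatest (fun p => (H p).length ≤ v) j, Nat.findGreatest_le j,
      Nat.findGreatest_spec (P := fun p => (H p).length ≤ v) (Nat.zero_le j) (by omega),
      fun p hp hpj => not_le.1 (Nat.findGreatest_is_greatest (P := fun p => (H p).length ≤ v) hp hpj)⟩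
  obtain ⟨k, hjk, hk, hkl, hkmin⟩ : ∃ k, j ≤ k ∧ (H k).length ≤ v ∧ k ≤ ℓ ∧
      ∀ p, j ≤ p → p < k → v < (H p).length :=
    ⟨Nat.find hex, (Nat.find_spec hex).1, (Nat.find_spec hex).2,
      Nat.find_min' hex ⟨hj, by omega⟩,
      fun p hp hpk => not_le.1 fun hle => Nat.find_min hex hpk ⟨hp, hle⟩⟩
  have hij' : i < j := lt_of_le_of_ne hij (by rintro rfl; omega)
  have hjk' : j < k := lt_of_le_of_ne hjk (by rintro rfl; omega)
  have hbetween : ∀ p, i < p → p < k → v < (H p).length := fun p hip hpk =>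
    (le_total p j).elim (himax p hip) fun hjp => hkmin p hjp hpk
  obtain ⟨hiv, hencap, hsuf⟩ :=
    AdaptFun.encap_of_apply_of_length (hv i (by omega)) hi (hbetween (i + 1) (by omega) (by omega))
  have hlast := hv (k - 1) (by omega)
  rw [Nat.sub_add_cancel (by omega : 1 ≤ k)] at hlast
  obtain ⟨hkv, hdecap⟩ :=
    AdaptFun.decap_of_apply_of_length hlast (hbetween (k - 1) (by omega) (by omega)) hk
  have hsufk : H i <:+ H k := hv.isSuffix hsuf (by omega) hkl fun p hp hpk =>
    hiv ▸ hbetween p hp hpk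
  exact ⟨i, k, hij, hjk, hkl, hiv, hkv, hbetween, hencap, hdecap,
    hsufk.eq_of_length (hiv.trans hkv.symm)⟩
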